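/- Let n ≥ 1 be an integer and p a prime number. Suppose that every polynomial P of degree n over the algebraic closure of 𝔽_p that is not coprime with each of its first n−1 Hasse derivatives is of the form c·(X − r)^n. Then for every natural number e and every field K of characteristic 0, every polynomial P ∈ K[X] of degree m = n·p^e that is not coprime with each of its first m−1 Hasse derivatives is of the form c·(X − r)^m with c, r ∈ K. -/

import Mathlib

open Polynomial

/-- the Casas-Alvero condition on a multiset of roots -/
def CAroots {R : Type*} [CommRing R] (s : Multiset R) : Prop :=
  ∀ j : ℕ, 1 ≤ j → j < Multiset.card s → ∃ a ∈ s, (s.map (fun b => a - b)).esymm j = 0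

lemma ca_eval_hasse {R : Type*} [CommRing R] (s : Multiset R) (a : R) (j : ℕ)
    (hj : j ≤ Multiset.card s) :
    (hasseDeriv j (s.map (fun b => X - C b)).prod).eval a =
      (s.map (fun b => a - b)).esymm (Multiset.card s - j) := by
  rw [← taylor_coeff, ← Multiset.prod_X_add_C_coeff' s (fun b => a - b) hj,
    ← coe_taylorAlgHom]
  congr 1
  change (taylorAlgHom a) _ = _
  rw [map_multiset_prod, Multiset.map_map]
  congr 1
  apply Multiset.map_congr rfl
  intro b _
  simp [taylor_X]
  ring

lemma ca_map_esymm {R S : Type*} [CommRing R] [CommRing S] (f : R →+* S) (s : Multiset R) (j : ℕ) :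
    (s.map f).esymm j = f (s.esymm j) := by
  simp [Multiset.esymm, Multiset.powersetCard_map, Multiset.map_map, map_multiset_sum,
    map_multiset_prod, Function.comp_def]

lemma ca_smul_esymm {R : Type*} [CommRing R] (c : R) (s : Multiset R) (j : ℕ) :
    (s.map (fun x => c * x)).esymm j = c ^ j * s.esymm j := by
  rw [Multiset.esymm, Multiset.esymm, ← Multiset.sum_map_mul_left, Multiset.powersetCard_map,
    Multiset.map_map]
  congr 1
  apply Multiset.map_congr rfl
  intro t ht
  rw [Multiset.mem_powersetCard] at ht
  have := Multiset.prod_map_mul (m := t) (f := fun _ => c) (g := fun x => x)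
  simpa [ht.2] using this

lemma CAroots.map {R S : Type*} [CommRing R] [CommRing S] (f : R →+* S) {s : Multiset R}
    (h : CAroots s) : CAroots (s.map f) := by
  intro j h1 h2
  rw [Multiset.card_map] at h2
  obtain ⟨a, ha, h0⟩ := h j h1 h2
  refine ⟨f a, Multiset.mem_map_of_mem f ha, ?_⟩
  have := ca_map_esymm f (s.map (fun b => a - b)) j
  rw [h0, map_zero] at this
  rw [← this, Multiset.map_map, Multiset.map_map]
  simp [Function.comp_def]

lemma CAroots.of_map {R S : Type*} [CommRing R] [CommRing S] (f : R →+* S)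
    (hf : Function.Injective f) {s : Multiset R}
    (h : CAroots (s.map f)) : CAroots s := by
  intro j h1 h2
  obtain ⟨a', ha', h0⟩ := h j h1 (by simpa using h2)
  obtain ⟨a, ha, rfl⟩ := Multiset.mem_map.1 ha'
  refine ⟨a, ha, hf ?_⟩
  rw [← ca_map_esymm, map_zero, ← h0, Multiset.map_map, Multiset.map_map]
  simp [Function.comp_def]

lemma CAroots.affine {R : Type*} [CommRing R] (c d : R) {s : Multiset R}
    (h : CAroots s) : CAroots (s.map (fun x => c * (x - d))) := by
  intro j h1 h2
  rw [Multiset.card_map] at h2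
  obtain ⟨a, ha, h0⟩ := h j h1 h2
  refine ⟨c * (a - d), Multiset.mem_map_of_mem _ ha, ?_⟩
  have := ca_smul_esymm c (s.map (fun b => a - b)) j
  rw [h0, mul_zero] at this
  rw [← this, Multiset.map_map, Multiset.map_map]
  congr 1
  apply Multiset.map_congr rfl
  intro x _
  simp only [Function.comp]
  ring

lemma ca_choose {F : Type*} [Field F] (p : ℕ) [Fact p.Prime] [CharP F p] (e k j : ℕ) :
    ((p ^ e * k).choose j : F) = if p ^ e ∣ j then (k.choose (j / p ^ e) : F) else 0 := by
  have hp : 0 < p ^ e := pow_pos (Fact.out : p.Prime).pos e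
  rw [← coeff_X_add_one_pow, ← coeff_X_add_one_pow, ← coeff_expand hp, pow_mul,
    add_pow_char_pow]
  simp

lemma ca_expand_of {F : Type*} [Field F] (p : ℕ) [Fact p.Prime] [CharP F p] (n e : ℕ)
    (P : F[X]) (hd : P.natDegree = n * p ^ e)
    (h : ∀ i, 1 ≤ i → i ≤ n * p ^ e - 1 → ∃ a, P.eval a = 0 ∧ (hasseDeriv i P).eval a = 0) :
    ∃ Q : F[X], P = expand F (p ^ e) Q := by
  have hp : 0 < p ^ e := pow_pos (Fact.out : p.Prime).pos e
  have key : ∀ i j, i + j = n * p ^ e → ¬ p ^ e ∣ j → P.coeff j = 0 := by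
    intro i
    induction i using Nat.strong_induction_on with
    | _ i ih =>
      intro j hij hj
      have hj0 : j ≠ 0 := by rintro rfl; simp at hj
      have hj1 : j ≠ n * p ^ e := by rintro rfl; simp at hj
      obtain ⟨a, -, ha⟩ := h j (by omega) (by omega)
      have : hasseDeriv j P = C (P.coeff j) := by
        ext k
        rw [hasseDeriv_coeff, coeff_C]
        rcases Nat.eq_zero_or_pos k with rfl | hk
        · simp
        · rw [if_neg (by omega)]
          by_cases hk2 : p ^ e ∣ k + j
          · obtain ⟨l, hl⟩ := hk2
            rw [hl, ca_choose p, if_neg hj, zero_mul]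
          · by_cases hk3 : k + j ≤ n * p ^ e
            · rw [ih (i - k) (by omega) (k + j) (by omega) hk2, mul_zero]
            · rw [coeff_eq_zero_of_natDegree_lt (n := k + j) (by omega), mul_zero]
      rw [this, eval_C] at ha
      exact ha
  refine ⟨contract (p ^ e) P, ?_⟩
  ext j
  rw [coeff_expand hp]
  split_ifs with hj
  · rw [coeff_contract hp.ne', Nat.div_mul_cancel hj]
  · by_cases hk3 : j ≤ n * p ^ e
    · exact key (n * p ^ e - j) j (by omega) hj
    · rw [coeff_eq_zero_of_natDegree_lt (by omega)]

lemma ca_hasse_expand {F : Type*} [Field F] (p : ℕ) [Fact p.Prime] [CharP F p] (e i : ℕ)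
    (Q : F[X]) :
    hasseDeriv (p ^ e * i) (expand F (p ^ e) Q) = expand F (p ^ e) (hasseDeriv i Q) := by
  have hp : 0 < p ^ e := pow_pos (Fact.out : p.Prime).pos e
  ext k
  rw [hasseDeriv_coeff, coeff_expand hp, coeff_expand hp]
  by_cases hk : p ^ e ∣ k
  · obtain ⟨l, rfl⟩ := hk
    rw [if_pos (by rw [← mul_add]; exact dvd_mul_right _ _), if_pos (dvd_mul_right _ _),
      hasseDeriv_coeff, ← mul_add, ca_choose p, if_pos (dvd_mul_right _ _)]
    simp [Nat.mul_div_cancel_left _ hp]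
  · rw [if_neg hk, if_neg, mul_zero]
    rwa [Nat.dvd_add_left (dvd_mul_right _ _)]

/-- the statement for the algebraic closure of the prime field -/
lemma ca_false_closure (n : ℕ) (hn : 1 ≤ n) (p : ℕ) [Fact p.Prime]
    (H : ∀ P : Polynomial (AlgebraicClosure (ZMod p)), P.degree = n →
      (∀ i : ℕ, 1 ≤ i → i ≤ n - 1 → ¬ IsCoprime P (hasseDeriv i P)) →
      ∃ c r : AlgebraicClosure (ZMod p), P = C c * (X - C r) ^ n) (e : ℕ)
    (s : Multiset (AlgebraicClosure (ZMod p))) (hs : Multiset.card s = n * p ^ e)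
    (h : CAroots s) (h0 : 0 ∈ s) (h1 : 1 ∈ s) : False := by
  have hp : 0 < p ^ e := pow_pos (Fact.out : p.Prime).pos e
  have : CharP (AlgebraicClosure (ZMod p)) p := inferInstance
  set P := (s.map (fun b => X - C b)).prod with hP
  have hroot : ∀ a ∈ s, P.eval a = 0 := by
    intro a ha
    rw [hP, eval_multiset_prod, Multiset.map_map]
    apply Multiset.prod_eq_zero
    rw [Multiset.mem_map]
    exact ⟨a, ha, by simp⟩
  have hdeg : P.natDegree = n * p ^ e := by
    rw [hP, natDegree_multiset_prod_X_sub_C_eq_card, hs]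
  have hP0 : P ≠ 0 := (monic_multiset_prod_of_monic _ _ (fun a _ => monic_X_sub_C a)).ne_zero
  have hc : ∀ i, 1 ≤ i → i ≤ n * p ^ e - 1 →
      ∃ a, P.eval a = 0 ∧ (hasseDeriv i P).eval a = 0 := by
    intro i hi1 hi2
    obtain ⟨a, ha, ha0⟩ := h (Multiset.card s - i) (by omega) (by omega)
    exact ⟨a, hroot a ha, by rw [hP, ca_eval_hasse _ _ _ (by omega), ha0]⟩
  obtain ⟨Q, hQ⟩ := ca_expand_of p n e P hdeg hc
  have hQ0 : Q ≠ 0 := by rintro rfl; simp at hQ; exact hP0 hQ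
  have hQd : Q.natDegree = n := by
    rw [hQ, natDegree_expand] at hdeg
    exact Nat.eq_of_mul_eq_mul_right hp hdeg
  obtain ⟨c, r, hcr⟩ := H Q (by rw [degree_eq_natDegree hQ0, hQd]) (by
    intro i hi1 hi2 hcop
    have hle : p ^ e * i + 1 ≤ n * p ^ e := by
      have : p ^ e * (i + 1) ≤ p ^ e * n := Nat.mul_le_mul_left _ (by omega)
      nlinarith
    obtain ⟨a, ha, hb⟩ := hc (p ^ e * i) (Nat.mul_pos hp hi1) (by omega)
    rw [hQ, ca_hasse_expand, expand_eval] at hb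
    rw [hQ, expand_eval] at ha
    obtain ⟨u, v, huv⟩ := hcop
    have := congrArg (eval (a ^ p ^ e)) huv
    simp [ha, hb] at this)
  have hc0 : c ≠ 0 := by rintro rfl; simp at hcr; exact hQ0 hcr
  have e0 := hroot 0 h0
  have e1 := hroot 1 h1
  rw [hQ, expand_eval, hcr] at e0 e1
  rw [zero_pow hp.ne'] at e0
  simp [hc0, show n ≠ 0 by omega] at e0 e1
  simp [e0] at e1

lemma ca_hom_field (F B : Type*) [Field F] [Field B] [Algebra F B] [Module.Finite F B] :
    Nonempty (B →ₐ[F] AlgebraicClosure F) := ⟨IsAlgClosed.lift⟩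

lemma ca_hom_closure (F A : Type*) [Field F] [CommRing A] [Nontrivial A] [Algebra F A]
    [Algebra.FiniteType F A] : Nonempty (A →ₐ[F] AlgebraicClosure F) := by
  obtain ⟨M, hM⟩ := Ideal.exists_maximal A
  let _ : Field (A ⧸ M) := Ideal.Quotient.field M
  have : Algebra.FiniteType F (A ⧸ M) :=
    Algebra.FiniteType.of_surjective (Ideal.Quotient.mkₐ F M)
      (Ideal.Quotient.mkₐ_surjective _ _)
  have : Module.Finite F (A ⧸ M) := finite_of_finite_type_of_isJacobsonRing _ _
  obtain ⟨f⟩ := ca_hom_field F (A ⧸ M)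
  exact ⟨f.comp (Ideal.Quotient.mkₐ F M)⟩

lemma ca_false_charp (n : ℕ) (hn : 1 ≤ n) (p : ℕ) [Fact p.Prime]
    (H : ∀ P : Polynomial (AlgebraicClosure (ZMod p)), P.degree = n →
      (∀ i : ℕ, 1 ≤ i → i ≤ n - 1 → ¬ IsCoprime P (hasseDeriv i P)) →
      ∃ c r : AlgebraicClosure (ZMod p), P = C c * (X - C r) ^ n) (e : ℕ)
    (k : Type*) [Field k] [CharP k p]
    (s : Multiset k) (hs : Multiset.card s = n * p ^ e)
    (h : CAroots s) (h0 : 0 ∈ s) (h1 : 1 ∈ s) : False := by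
  classical
  let _ : Algebra (ZMod p) k := ZMod.algebra k p
  let A := Algebra.adjoin (ZMod p) (s.toFinset : Set k)
  have : Algebra.FiniteType (ZMod p) A := A.fg_iff_finiteType.1 ⟨s.toFinset, rfl⟩
  obtain ⟨g'⟩ := ca_hom_closure (ZMod p) A
  let g : A →+* AlgebraicClosure (ZMod p) := g'.toRingHom
  have hmem : ∀ x ∈ s, x ∈ A := fun x hx => Algebra.subset_adjoin (by simpa using hx)
  obtain ⟨t, ht⟩ : ∃ t : Multiset A, t.map (A.val : A →+* k) = s := by
    refine ⟨s.attach.map (fun x => ⟨x.1, hmem x.1 x.2⟩), ?_⟩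
    rw [Multiset.map_map]
    exact Multiset.attach_map_val s
  have key : ∀ x : A, (x : k) ∈ s → x ∈ t := by
    intro x hx
    rw [← ht, Multiset.mem_map] at hx
    obtain ⟨y, hy, hyx⟩ := hx
    rwa [← Subtype.ext hyx]
  refine ca_false_closure n hn p H e (t.map g) ?_ ?_ ?_ ?_
  · rw [Multiset.card_map, ← hs, ← ht, Multiset.card_map]
  · refine CAroots.map g (CAroots.of_map (A.val : A →+* k) Subtype.val_injective ?_)
    rwa [ht]
  · rw [← map_zero g]
    exact Multiset.mem_map_of_mem g (key 0 (by simpa using h0))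
  · rw [← map_one g]
    exact Multiset.mem_map_of_mem g (key 1 (by simpa using h1))

lemma ca_exists_val (L : Type*) [Field L] [CharZero L] (p : ℕ) [Fact p.Prime] :
    ∃ V : ValuationSubring L, (p : L) ∈ V.nonunits := by
  let A : Subring L := (Int.castRingHom L).range
  obtain ⟨V, -, hV⟩ := Ideal.image_subset_nonunits_valuationSubring (A := A)
    (Ideal.span {(p : A)}) (by
      rw [Ne, Ideal.span_singleton_eq_top]
      rintro hu
      obtain ⟨⟨_, z, rfl⟩, hy⟩ := hu.exists_right_inv
      have h2 := congrArg (Subtype.val) hy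
      have h3 : ((p : ℤ) : L) * (z : L) = ((1 : ℤ) : L) := by simpa using h2
      have h4 : (p : ℤ) * z = 1 := by exact_mod_cast h3
      have h5 : (p : ℤ) ∣ 1 := ⟨z, h4.symm⟩
      have h6 : p ∣ 1 := by exact_mod_cast h5
      exact (Fact.out : p.Prime).one_lt.ne' (Nat.dvd_one.1 h6))
  exact ⟨V, hV ⟨(p : A), Ideal.subset_span rfl, by simp⟩⟩

lemma ca_all_eq (n : ℕ) (hn : 1 ≤ n) (p : ℕ) [Fact p.Prime]
    (H : ∀ P : Polynomial (AlgebraicClosure (ZMod p)), P.degree = n →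
      (∀ i : ℕ, 1 ≤ i → i ≤ n - 1 → ¬ IsCoprime P (hasseDeriv i P)) →
      ∃ c r : AlgebraicClosure (ZMod p), P = C c * (X - C r) ^ n) (e : ℕ)
    (L : Type*) [Field L] [CharZero L]
    (s : Multiset L) (hs : Multiset.card s = n * p ^ e)
    (h : CAroots s) (a b : L) (ha : a ∈ s) (hb : b ∈ s) : b = a := by
  classical
  by_contra hab
  obtain ⟨V, hV⟩ := ca_exists_val L p
  obtain ⟨d, hd, hmax⟩ := s.toFinset.exists_max_image (fun x => V.valuation (x - a))
    ⟨a, by simpa using ha⟩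
  have hda : d - a ≠ 0 := by
    intro h0
    have := hmax b (by simpa using hb)
    simp only [h0, map_zero, le_zero_iff, map_eq_zero] at this
    exact hab (sub_eq_zero.1 this)
  have hs' := h.affine (d - a)⁻¹ a
  set s' := s.map (fun x => (d - a)⁻¹ * (x - a)) with hs'def
  have hmem : ∀ x ∈ s', x ∈ V := by
    intro x hx
    rw [hs'def, Multiset.mem_map] at hx
    obtain ⟨y, hy, rfl⟩ := hx
    rw [← V.valuation_le_one_iff, map_mul, map_inv₀]
    have h1 := hmax y (by simpa using hy)
    have h2 : V.valuation (d - a) ≠ 0 := by simpa using hda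
    calc _ ≤ (V.valuation (d - a))⁻¹ * V.valuation (d - a) := by gcongr
      _ = 1 := inv_mul_cancel₀ h2
  obtain ⟨t, ht⟩ : ∃ t : Multiset V, t.map V.subtype = s' := by
    refine ⟨s'.attach.map (fun x => ⟨x.1, hmem x.1 x.2⟩), ?_⟩
    rw [Multiset.map_map]
    exact Multiset.attach_map_val s'
  have key : ∀ x : V, (x : L) ∈ s' → x ∈ t := by
    intro x hx
    rw [← ht, Multiset.mem_map] at hx
    obtain ⟨y, hy, hyx⟩ := hx
    rwa [← Subtype.ext hyx]
  let g := IsLocalRing.residue V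
  have : CharP (IsLocalRing.ResidueField V) p := by
    have : ((p : ℕ) : IsLocalRing.ResidueField V) = 0 := by
      rw [← map_natCast g, IsLocalRing.residue_eq_zero_iff]
      exact ValuationSubring.coe_mem_nonunits_iff.1 (by simpa using hV)
    exact (CharP.charP_iff_prime_eq_zero (Fact.out : p.Prime)).2 this
  refine ca_false_charp n hn p H e (IsLocalRing.ResidueField V) (t.map g) ?_ ?_ ?_ ?_
  · rw [Multiset.card_map, ← hs, ← Multiset.card_map V.subtype, ht, hs'def, Multiset.card_map]
  · refine CAroots.map g (CAroots.of_map V.subtype Subtype.val_injective ?_)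
    rwa [ht]
  · rw [← map_zero g]
    refine Multiset.mem_map_of_mem g (key 0 ?_)
    rw [hs'def, Multiset.mem_map]
    exact ⟨a, ha, by simp⟩
  · rw [← map_one g]
    refine Multiset.mem_map_of_mem g (key 1 ?_)
    rw [hs'def, Multiset.mem_map]
    exact ⟨d, by simpa using hd, by simp [hda]⟩

lemma ca_main (n : ℕ) (hn : 1 ≤ n) (p : ℕ) [Fact p.Prime]
    (H : ∀ P : Polynomial (AlgebraicClosure (ZMod p)), P.degree = n →
      (∀ i : ℕ, 1 ≤ i → i ≤ n - 1 → ¬ IsCoprime P (hasseDeriv i P)) →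
      ∃ c r : AlgebraicClosure (ZMod p), P = C c * (X - C r) ^ n)
    (e : ℕ) (K L : Type*) [Field K] [CharZero K] [Field L] [Algebra K L] [IsAlgClosed L] (P : K[X])
    (hdeg : P.degree = (n * p ^ e : ℕ))
    (hP : ∀ i : ℕ, 1 ≤ i → i ≤ n * p ^ e - 1 → ¬ IsCoprime P (hasseDeriv i P)) :
    ∃ c r : K, P = C c * (X - C r) ^ (n * p ^ e) := by
  have hp : 0 < p ^ e := pow_pos (Fact.out : p.Prime).pos e
  have hm : 0 < n * p ^ e := Nat.mul_pos hn hp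
  have hP0 : P ≠ 0 := by rintro rfl; rw [degree_zero] at hdeg; exact WithBot.bot_ne_coe hdeg
  have hnd : P.natDegree = n * p ^ e := natDegree_eq_of_degree_eq_some hdeg
  set m := n * p ^ e with hmdef
  have : CharZero L := charZero_of_injective_algebraMap (algebraMap K L).injective
  let φ := algebraMap K L
  let PL := P.map φ
  have hPL0 : PL ≠ 0 := (Polynomial.map_ne_zero_iff φ.injective).2 hP0
  have hsp : PL.Splits := IsAlgClosed.splits PL
  have hcard : Multiset.card PL.roots = m := by
    rw [← hsp.natDegree_eq_card_roots, natDegree_map, hnd]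
  have hprod := hsp.eq_prod_roots
  have hlc : PL.leadingCoeff ≠ 0 := leadingCoeff_ne_zero.2 hPL0
  have hCA : CAroots PL.roots := by
    intro j hj1 hj2
    have := hP (m - j) (by omega) (by omega)
    rw [Polynomial.isCoprime_iff_aeval_ne_zero_of_isAlgClosed K L] at this
    push Not at this
    obtain ⟨a, ha, hb⟩ := this
    refine ⟨a, ?_, ?_⟩
    · rw [mem_roots hPL0, IsRoot, eval_map_algebraMap, ha]
    · have e1 : (hasseDeriv (m - j) PL).eval a = 0 := by
        rw [← taylor_coeff] 
        rw [← eval_map_algebraMap] at hb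
        rw [taylor_coeff, ← hb]
        congr 1
        ext k
        simp [PL, hasseDeriv_coeff, φ]
      rw [hprod, ← smul_eq_C_mul, map_smul, eval_smul, ca_eval_hasse _ _ _ (by omega),
        smul_eq_mul, mul_eq_zero] at e1
      rcases e1 with e1 | e1
      · exact absurd e1 hlc
      · rwa [hcard, Nat.sub_sub_self (by omega)] at e1
  obtain ⟨a, ha⟩ := Multiset.card_pos_iff_exists_mem.1 (show 0 < Multiset.card PL.roots by omega)
  have hrep : PL.roots = Multiset.replicate m a :=
    Multiset.eq_replicate.2 ⟨hcard, fun b hb => ca_all_eq n hn p H e L _ hcard hCA a b ha hb⟩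
  -- descent
  have hm0 : (m : K) ≠ 0 := by exact_mod_cast hm.ne'
  have hsum := multiset_prod_X_sub_C_coeff_card_pred PL.roots (by omega)
  have hco : φ (P.coeff (m - 1)) = φ P.leadingCoeff * (-(m * a)) := by
    have h1 : PL.coeff (m - 1) = φ (P.coeff (m - 1)) := coeff_map _ _
    rw [← h1, hprod, coeff_C_mul, ← hcard, hsum, hrep]
    simp [PL, leadingCoeff_map]
  have hlK : P.leadingCoeff ≠ 0 := leadingCoeff_ne_zero.2 hP0
  have har : φ (-(P.coeff (m - 1)) / (P.leadingCoeff * m)) = a := by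
    rw [map_div₀, map_neg, hco, map_mul, map_natCast]
    have h1 : φ P.leadingCoeff ≠ 0 := by simpa using hlK
    have h2 : (m : L) ≠ 0 := by exact_mod_cast hm.ne'
    field_simp
  refine ⟨P.leadingCoeff, -(P.coeff (m - 1)) / (P.leadingCoeff * m), ?_⟩
  apply Polynomial.map_injective φ φ.injective
  change PL = _
  rw [hprod, hrep]
  simp only [Polynomial.map_mul, Polynomial.map_pow, Polynomial.map_sub, map_C, map_X, har]
  simp [PL, leadingCoeff_map]

theorem casas_alvero_charp_to_char0 (n : ℕ) (hn : 1 ≤ n) (p : ℕ) [Fact p.Prime]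
    (H : ∀ P : Polynomial (AlgebraicClosure (ZMod p)), P.degree = n →
      (∀ i : ℕ, 1 ≤ i → i ≤ n - 1 → ¬ IsCoprime P (hasseDeriv i P)) →
      ∃ c r : AlgebraicClosure (ZMod p), P = C c * (X - C r) ^ n) :
    ∀ (e : ℕ) (K : Type*) [Field K] [CharZero K] (P : K[X]),
      P.degree = (n * p ^ e : ℕ) →
      (∀ i : ℕ, 1 ≤ i → i ≤ n * p ^ e - 1 → ¬ IsCoprime P (hasseDeriv i P)) →
      ∃ c r : K, P = C c * (X - C r) ^ (n * p ^ e) := by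
  intro e K _ _ P hdeg hP
  exact ca_main n hn p H e K (AlgebraicClosure K) P hdeg hP
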